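/- Let q be odd, C_1, C_2 linear codes of length n over F_q, and C = {[u+v, u−v] : u ∈ C_1, v ∈ C_2} ⊆ F_q^{2n}. Then for 1 ≤ b ≤ n: (i) d_b(C) ≥ min{2d_b(C_1), d_b(C_2)}; (ii) d_b(C) ≥ min{d_b(C_1), 2d_b(C_2)}; (iii) min{d_b(C_1), d_b(C_2)} ≤ d_b(C) ≤ 2·min{d_b(C_1), d_b(C_2)}. -/

import Mathlib

open scoped Classical
open Finset

noncomputable def bwt {F : Type*} [Field F] (n b : ℕ) [NeZero n] (x : ZMod n → F) : ℕ :=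
  (Finset.univ.filter (fun i : ZMod n => ∃ j < b, x (i + (j : ZMod n)) ≠ 0)).card

noncomputable def bDist {F : Type*} [Field F] (n b : ℕ) [NeZero n]
    (C : Set (ZMod n → F)) : ℕ :=
  sInf {w | ∃ u ∈ C, ∃ v ∈ C, u ≠ v ∧ bwt n b (u - v) = w}

def IsHole {n : ℕ} [NeZero n] (J H : Finset (ZMod n)) : Prop :=
  ∃ (a : ZMod n) (h : ℕ), 0 < h ∧
    H = Finset.image (fun t : ℕ => a + (t : ZMod n) + 1) (Finset.range h) ∧
    (∀ x ∈ H, x ∉ J) ∧ a ∈ J ∧ a + (h : ZMod n) + 1 ∈ J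

noncomputable def hSupp {F : Type*} [Field F] {n : ℕ} [NeZero n] (x : ZMod n → F) :
    Finset (ZMod n) :=
  Finset.univ.filter (fun i => x i ≠ 0)
instance neZeroTwoMul {n : ℕ} [NeZero n] : NeZero (2 * n) :=
  ⟨Nat.mul_ne_zero two_ne_zero (NeZero.ne n)⟩

/-- The vector `[u+v, u-v]` of length `2n` (0-based coordinates). -/
noncomputable def pmVec {F : Type*} [Field F] (n : ℕ) [NeZero n]
    (u v : ZMod n → F) : ZMod (2 * n) → F :=
  fun k =>
    if k.val < n then u ((k.val : ℕ) : ZMod n) + v ((k.val : ℕ) : ZMod n)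
    else u ((k.val - n : ℕ) : ZMod n) - v ((k.val - n : ℕ) : ZMod n)

/-- The `[u+v, u-v]`-construction `C = {[u+v, u-v] : u ∈ C₁, v ∈ C₂}`. -/
noncomputable def pmCode {F : Type*} [Field F] (n : ℕ) [NeZero n]
    (C₁ C₂ : Submodule F (ZMod n → F)) : Set (ZMod (2 * n) → F) :=
  {w | ∃ u ∈ C₁, ∃ v ∈ C₂, w = pmVec n u v}

noncomputable def redHom (n : ℕ) [NeZero n] : ZMod (2 * n) →+* ZMod n :=
  ZMod.castHom (Dvd.intro_left 2 rfl) (ZMod n)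

lemma redHom_natCast (n : ℕ) [NeZero n] (k : ℕ) : redHom n (k : ZMod (2 * n)) = (k : ZMod n) :=
  map_natCast _ _

lemma redHom_val (n : ℕ) [NeZero n] (k : ZMod (2 * n)) :
    ((k.val : ℕ) : ZMod n) = redHom n k := by
  rw [← redHom_natCast, ZMod.natCast_zmod_val]

lemma pmVec_eq {F : Type*} [Field F] (n : ℕ) [NeZero n] (u v : ZMod n → F) (k : ZMod (2 * n)) :
    pmVec n u v k = if k.val < n then u (redHom n k) + v (redHom n k)
      else u (redHom n k) - v (redHom n k) := by
  unfold pmVec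
  by_cases h : k.val < n
  · simp only [h, if_true, redHom_val]
  · have h' : ((k.val - n : ℕ) : ZMod n) = redHom n k := by
      rw [Nat.cast_sub (by omega), redHom_val]; simp
    simp only [h, if_false, h']

lemma val_add_lt_iff (n : ℕ) [NeZero n] (k : ZMod (2 * n)) :
    (k + (n : ZMod (2 * n))).val < n ↔ ¬ k.val < n := by
  have hn : 0 < n := Nat.pos_of_ne_zero (NeZero.ne n)
  have hk := ZMod.val_lt k
  rw [ZMod.val_add, ZMod.val_natCast, Nat.mod_eq_of_lt (show n < 2 * n by omega)]
  by_cases h : k.val < n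
  · rw [Nat.mod_eq_of_lt (by omega)]; omega
  · rw [Nat.mod_eq_sub_mod (by omega), Nat.mod_eq_of_lt (by omega)]; omega

lemma pmVec_shift {F : Type*} [Field F] (n : ℕ) [NeZero n] (u v : ZMod n → F)
    (k : ZMod (2 * n)) : 
    pmVec n u v (k + (n : ZMod (2 * n))) = if k.val < n then u (redHom n k) - v (redHom n k)
      else u (redHom n k) + v (redHom n k) := by
  rw [pmVec_eq]
  have : redHom n (k + (n : ZMod (2 * n))) = redHom n k := by
    rw [map_add, redHom_natCast]; simp
  rw [this]
  simp only [val_add_lt_iff]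
  split_ifs <;> rfl

lemma two_mul_card (n : ℕ) [NeZero n] (p : ZMod n → Prop) :
    (Finset.univ.filter (fun k : ZMod (2 * n) => p (redHom n k))).card
      = 2 * (Finset.univ.filter p).card := by
  have hn : 0 < n := Nat.pos_of_ne_zero (NeZero.ne n)
  let e : ZMod n × Bool → ZMod (2 * n) := fun x => ((x.1.val + if x.2 then n else 0 : ℕ) : ZMod (2*n))
  have hred : ∀ x, redHom n (e x) = x.1 := by
    rintro ⟨i, c⟩
    simp only [e, redHom_natCast]
    cases c <;> simp
  have hval : ∀ x, (e x).val = x.1.val + if x.2 then n else 0 := by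
    rintro ⟨i, c⟩
    have := ZMod.val_lt i
    simp only [e, ZMod.val_natCast]
    apply Nat.mod_eq_of_lt
    split_ifs <;> omega
  have hinj : Function.Injective e := by
    intro x y h
    have h1 : x.1 = y.1 := by rw [← hred x, ← hred y, h]
    have h2 := hval x
    rw [h, hval y, h1] at h2
    obtain ⟨i, c⟩ := x
    obtain ⟨j, d⟩ := y
    simp only at h1 h2
    subst h1
    cases c <;> cases d <;> simp at h2 ⊢ <;> omega
  have hbij : Function.Bijective e := by
    rw [Fintype.bijective_iff_injective_and_card]
    refine ⟨hinj, ?_⟩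
    simp [ZMod.card, mul_comm]
  have : (Finset.univ.filter (fun k : ZMod (2 * n) => p (redHom n k)))
      = ((Finset.univ.filter p) ×ˢ (Finset.univ : Finset Bool)).image e := by
    ext k
    obtain ⟨x, rfl⟩ := hbij.2 k
    simp only [Finset.mem_filter, Finset.mem_univ, true_and, hred, Finset.mem_image,
      Finset.mem_product, and_true]
    constructor
    · intro h; exact ⟨x, h, rfl⟩
    · rintro ⟨y, hy, hxy⟩; rwa [← hinj hxy]
  rw [this, Finset.card_image_of_injective _ hinj, Finset.card_product]
  simp [mul_comm]

lemma bwt_double {F : Type*} [Field F] (n b : ℕ) [NeZero n] (x : ZMod n → F)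
    (w : ZMod (2 * n) → F) (h : ∀ k, w k ≠ 0 ↔ x (redHom n k) ≠ 0) :
    bwt (2 * n) b w = 2 * bwt n b x := by
  unfold bwt
  have key := two_mul_card n (fun i : ZMod n => ∃ j < b, x (i + (j : ZMod n)) ≠ 0)
  convert key using 2
  · ext k
    simp only [Finset.mem_filter, h, map_add, redHom_natCast]
  · congr!

lemma bwt_le {F : Type*} [Field F] (n b : ℕ) [NeZero n] (x : ZMod n → F)
    (w : ZMod (2 * n) → F)
    (h : ∀ k, x (redHom n k) ≠ 0 → w k ≠ 0 ∨ w (k + (n : ZMod (2 * n))) ≠ 0) :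
    bwt n b x ≤ bwt (2 * n) b w := by
  unfold bwt
  refine le_trans (Finset.card_le_card ?_) (Finset.card_image_le (f := redHom n))
  intro i hi
  simp only [Finset.mem_filter, Finset.mem_univ, true_and, Finset.mem_image] at hi ⊢
  obtain ⟨j, hj, hx⟩ := hi
  have hi' : redHom n ((i.val : ℕ) : ZMod (2 * n)) = i := by
    rw [redHom_natCast, ZMod.natCast_zmod_val]
  rcases h (((i.val : ℕ) : ZMod (2 * n)) + (j : ZMod (2 * n)))
    (by rwa [map_add, hi', redHom_natCast]) with h | h
  · exact ⟨_, ⟨j, hj, h⟩, hi'⟩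
  · refine ⟨((i.val : ℕ) : ZMod (2 * n)) + (n : ZMod (2 * n)), ⟨j, hj, ?_⟩, ?_⟩
    · rwa [add_right_comm]
    · rw [map_add, hi', redHom_natCast]; simp

lemma pm_ne {F : Type*} [Field F] (h2 : (2 : F) ≠ 0) (a c : F) (h : a + c = 0) (h' : a - c = 0) :
    a = 0 ∧ c = 0 := by
  have ha : 2 * a = 0 := by linear_combination h + h'
  have hc : 2 * c = 0 := by linear_combination h - h'
  simp only [mul_eq_zero, h2, false_or] at ha hc
  exact ⟨ha, hc⟩

lemma le_pm_left {F : Type*} [Field F] (h2 : (2 : F) ≠ 0) (n b : ℕ) [NeZero n]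
    (u v : ZMod n → F) : bwt n b u ≤ bwt (2 * n) b (pmVec n u v) := by
  apply bwt_le
  intro k hk
  by_contra! hc
  rw [pmVec_eq, pmVec_shift] at hc
  split_ifs at hc
  · exact hk (pm_ne h2 _ _ hc.1 hc.2).1
  · exact hk (pm_ne h2 _ _ hc.2 hc.1).1

lemma le_pm_right {F : Type*} [Field F] (h2 : (2 : F) ≠ 0) (n b : ℕ) [NeZero n]
    (u v : ZMod n → F) : bwt n b v ≤ bwt (2 * n) b (pmVec n u v) := by
  apply bwt_le
  intro k hk
  by_contra! hc
  rw [pmVec_eq, pmVec_shift] at hc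
  split_ifs at hc
  · exact hk (pm_ne h2 _ _ hc.1 hc.2).2
  · exact hk (pm_ne h2 _ _ hc.2 hc.1).2

lemma bwt_pm_left {F : Type*} [Field F] (n b : ℕ) [NeZero n]
    (u : ZMod n → F) : bwt (2 * n) b (pmVec n u 0) = 2 * bwt n b u := by
  apply bwt_double
  intro k
  rw [pmVec_eq]; simp

lemma bwt_pm_right {F : Type*} [Field F] (n b : ℕ) [NeZero n]
    (v : ZMod n → F) : bwt (2 * n) b (pmVec n 0 v) = 2 * bwt n b v := by
  apply bwt_double
  intro k
  rw [pmVec_eq]; split_ifs <;> simp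

lemma pmVec_sub {F : Type*} [Field F] (n : ℕ) [NeZero n] (u v u' v' : ZMod n → F) :
    pmVec n u v - pmVec n u' v' = pmVec n (u - u') (v - v') := by
  ext k
  simp only [Pi.sub_apply, pmVec_eq]
  split_ifs <;> ring

lemma pmVec_zero {F : Type*} [Field F] (n : ℕ) [NeZero n] :
    pmVec n (0 : ZMod n → F) 0 = 0 := by
  ext k
  simp [pmVec_eq]

lemma bDist_le {F : Type*} [Field F] (n b : ℕ) [NeZero n] (C : Submodule F (ZMod n → F))
    (x : ZMod n → F) (hx : x ∈ C) (h0 : x ≠ 0) : bDist n b (C : Set (ZMod n → F)) ≤ bwt n b x :=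
  Nat.sInf_le ⟨x, hx, 0, C.zero_mem, h0, by rw [sub_zero]⟩

lemma bDist_attained {F : Type*} [Field F] (n b : ℕ) [NeZero n] (C : Submodule F (ZMod n → F))
    (h : ∃ x ∈ C, x ≠ 0) :
    ∃ x ∈ C, x ≠ 0 ∧ bwt n b x = bDist n b (C : Set (ZMod n → F)) := by
  obtain ⟨x, hx, h0⟩ := h
  obtain ⟨u, hu, v, hv, huv, hw⟩ := Nat.sInf_mem
    (s := {w | ∃ u ∈ (C : Set (ZMod n → F)), ∃ v ∈ (C : Set (ZMod n → F)), u ≠ v ∧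
      bwt n b (u - v) = w}) ⟨_, x, hx, 0, C.zero_mem, h0, rfl⟩
  exact ⟨u - v, C.sub_mem hu hv, sub_ne_zero.2 huv, hw⟩

lemma forall_and_eq_zero {F : Type*} [Field F] (n : ℕ) [NeZero n] (h2 : (2 : F) ≠ 0)
    (u v : ZMod n → F) (h : pmVec n u v = 0) : u = 0 ∧ v = 0 := by
  have key : ∀ i, u i = 0 ∧ v i = 0 := by
    intro i
    have hi' : redHom n ((i.val : ℕ) : ZMod (2 * n)) = i := by
      rw [redHom_natCast, ZMod.natCast_zmod_val]
    have e1 := pmVec_eq n u v ((i.val : ℕ) : ZMod (2 * n))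
    have e2 := pmVec_shift n u v ((i.val : ℕ) : ZMod (2 * n))
    rw [hi', h, Pi.zero_apply] at e1 e2
    split_ifs at e1 e2
    · exact pm_ne h2 _ _ e1.symm e2.symm
    · exact pm_ne h2 _ _ e2.symm e1.symm
  exact ⟨funext fun i => (key i).1, funext fun i => (key i).2⟩

/-- for `q` odd and `C = {[u+v, u-v]}`, the bounds
(i) `d_b(C) ≥ min{2d_b(C₁), d_b(C₂)}`, (ii) `d_b(C) ≥ min{d_b(C₁), 2d_b(C₂)}`,
(iii) `min{d_b(C₁), d_b(C₂)} ≤ d_b(C) ≤ 2·min{d_b(C₁), d_b(C₂)}` hold. -/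
theorem stmt16 {F : Type*} [Field F] [Fintype F] (hodd : Odd (Fintype.card F))
    {n b : ℕ} [NeZero n] (hb1 : 1 ≤ b) (hbn : b ≤ n)
    (C₁ C₂ : Submodule F (ZMod n → F))
    (h1 : ∃ x ∈ C₁, x ≠ (0 : ZMod n → F)) (h2 : ∃ x ∈ C₂, x ≠ (0 : ZMod n → F)) :
    min (2 * bDist n b (C₁ : Set (ZMod n → F))) (bDist n b (C₂ : Set (ZMod n → F)))
        ≤ bDist (2 * n) b (pmCode n C₁ C₂) ∧
    min (bDist n b (C₁ : Set (ZMod n → F))) (2 * bDist n b (C₂ : Set (ZMod n → F)))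
        ≤ bDist (2 * n) b (pmCode n C₁ C₂) ∧
    min (bDist n b (C₁ : Set (ZMod n → F))) (bDist n b (C₂ : Set (ZMod n → F)))
        ≤ bDist (2 * n) b (pmCode n C₁ C₂) ∧
    bDist (2 * n) b (pmCode n C₁ C₂)
        ≤ 2 * min (bDist n b (C₁ : Set (ZMod n → F)))
            (bDist n b (C₂ : Set (ZMod n → F))) := by
  have h2F : (2 : F) ≠ 0 := by
    intro h
    have hc : ringChar F = 2 := CharP.ringChar_of_prime_eq_zero Nat.prime_two (by exact_mod_cast h)
    have := FiniteField.even_card_iff_char_two.1 hc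
    have := Nat.odd_iff.1 hodd
    omega
  obtain ⟨x, hx, hx0, hxw⟩ := bDist_attained n b C₁ h1
  obtain ⟨y, hy, hy0, hyw⟩ := bDist_attained n b C₂ h2
  have ne0 : ∀ u v : ZMod n → F, (u ≠ 0 ∨ v ≠ 0) → pmVec n u v ≠ 0 := by
    intro u v huv h
    exact not_and_or.2 huv (forall_and_eq_zero n h2F u v h)
  have hle : ∀ u ∈ C₁, ∀ v ∈ C₂, (u ≠ 0 ∨ v ≠ 0) →
      bDist (2 * n) b (pmCode n C₁ C₂) ≤ bwt (2 * n) b (pmVec n u v) := by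
    intro u hu v hv huv
    refine Nat.sInf_le ⟨pmVec n u v, ⟨u, hu, v, hv, rfl⟩, 0,
      ⟨0, C₁.zero_mem, 0, C₂.zero_mem, (pmVec_zero n).symm⟩, ne0 u v huv, by rw [sub_zero]⟩
  have hA := hle x hx 0 C₂.zero_mem (Or.inl hx0)
  have hB := hle 0 C₁.zero_mem y hy (Or.inr hy0)
  rw [bwt_pm_left, hxw] at hA
  rw [bwt_pm_right, hyw] at hB
  obtain ⟨u, hu, v, hv, huv, hw⟩ : ∃ u ∈ C₁, ∃ v ∈ C₂, (u ≠ 0 ∨ v ≠ 0) ∧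
      bwt (2 * n) b (pmVec n u v) = bDist (2 * n) b (pmCode n C₁ C₂) := by
    obtain ⟨w, ⟨u, hu, v, hv, rfl⟩, w', ⟨u', hu', v', hv', rfl⟩, hne, hw⟩ := Nat.sInf_mem
      (s := {w | ∃ u ∈ pmCode n C₁ C₂, ∃ v ∈ pmCode n C₁ C₂, u ≠ v ∧
        bwt (2 * n) b (u - v) = w})
      ⟨_, pmVec n x 0, ⟨x, hx, 0, C₂.zero_mem, rfl⟩, 0,
      ⟨0, C₁.zero_mem, 0, C₂.zero_mem, (pmVec_zero n).symm⟩, ne0 x 0 (Or.inl hx0), rfl⟩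
    rw [pmVec_sub] at hw
    refine ⟨u - u', C₁.sub_mem hu hu', v - v', C₂.sub_mem hv hv', ?_, hw⟩
    by_contra! hc
    apply hne
    rw [sub_eq_zero.1 hc.1, sub_eq_zero.1 hc.2]
  rw [← hw] at hA hB ⊢
  have hL := le_pm_left h2F n b u v
  have hR := le_pm_right h2F n b u v
  by_cases hu0 : u = 0
  · have hv0 : v ≠ 0 := huv.resolve_left (not_not.2 hu0)
    have hd := bDist_le n b C₂ v hv hv0
    subst hu0
    rw [bwt_pm_right] at *
    omega
  · have hd := bDist_le n b C₁ u hu hu0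
    by_cases hv0 : v = 0
    · subst hv0
      rw [bwt_pm_left] at *
      omega
    · have hd' := bDist_le n b C₂ v hv hv0
      omega
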